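/- Let P be a convex-ranged probability charge on an algebra Σ and let γ ∈ (1/2, 1). Define set functions (h_t)_{t ∈ ℕ₀} on Σ recursively by: h_0(A) = 1 if P(A) > 1 − γ and h_0(A) = 0 otherwise; and for t ≥ 1, h_t(A) = min( sup_{B ∈ Σ} inf_{C ∈ Σ, C ⊆ Aᶜ} { h_{t−1}(A ∪ B) + h_{t−1}(A ∪ C) − h_{t−1}(B ∪ C) }, 1 ). Then for every t ∈ ℕ₀: (i) for all A, A′ ∈ Σ, P(A) ≤ P(A′) implies h_t(A) ≤ h_t(A′); (ii) h_t(∅) = 0; and (iii) h_t(A) = 1 if P(A) > 2^{−t}·(1 − γ) and h_t(A) = 0 otherwise. -/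

import Mathlib

/-- A bounded signed charge on the algebra `S` of subsets of `Ω`: a finitely additive,
bounded real-valued set function, normalised to vanish outside `S`. -/
structure Charge {Ω : Type*} (S : Set (Set Ω)) where
  toFun : Set Ω → ℝ
  zero_of_not_mem : ∀ A : Set Ω, A ∉ S → toFun A = 0
  additive : ∀ A B : Set Ω, A ∈ S → B ∈ S → Disjoint A B → toFun (A ∪ B) = toFun A + toFun B
  bounded : ∃ C : ℝ, ∀ A : Set Ω, |toFun A| ≤ C

namespace Charge

variable {Ω : Type*} {S : Set (Set Ω)}

theorem ext' {μ ν : Charge S} (h : μ.toFun = ν.toFun) : μ = ν := by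
  cases μ; cases ν; simpa using h

noncomputable instance : SMul ℝ (Charge S) :=
  ⟨fun a μ =>
    { toFun := fun A => a * μ.toFun A
      zero_of_not_mem := fun A hA => by
        show a * μ.toFun A = 0
        rw [μ.zero_of_not_mem A hA, mul_zero]
      additive := fun A B hA hB hAB => by
        show a * μ.toFun (A ∪ B) = a * μ.toFun A + a * μ.toFun B
        rw [μ.additive A B hA hB hAB]; ring
      bounded := by
        obtain ⟨C, hC⟩ := μ.bounded
        refine ⟨|a| * C, fun A => ?_⟩
        show |a * μ.toFun A| ≤ |a| * C
        rw [abs_mul]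
        exact mul_le_mul_of_nonneg_left (hC A) (abs_nonneg a) }⟩

@[simp] theorem smul_toFun (a : ℝ) (μ : Charge S) (A : Set Ω) :
    (a • μ).toFun A = a * μ.toFun A := rfl

/-- The setwise (partial) order on bounded charges. -/
instance : PartialOrder (Charge S) where
  le μ ν := ∀ A ∈ S, μ.toFun A ≤ ν.toFun A
  le_refl μ A _ := le_refl _
  le_trans μ ν ξ h1 h2 A hA := le_trans (h1 A hA) (h2 A hA)
  le_antisymm μ ν h1 h2 := ext' (funext fun A => by
    by_cases hA : A ∈ S
    · exact le_antisymm (h1 A hA) (h2 A hA)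
    · rw [μ.zero_of_not_mem A hA, ν.zero_of_not_mem A hA])

theorem le_def {μ ν : Charge S} : μ ≤ ν ↔ ∀ A ∈ S, μ.toFun A ≤ ν.toFun A := Iff.rfl

end Charge

/-- A probability charge: nonnegative, with total mass one. -/
def IsProbCharge {Ω : Type*} {S : Set (Set Ω)} (P : Charge S) : Prop :=
  P.toFun Set.univ = 1 ∧ ∀ A : Set Ω, 0 ≤ P.toFun A

/-- A charge `P` has convex range if for every `A ∈ S` the set of values `P(B)`,
`B ∈ S`, `B ⊆ A`, is the full interval `[0, P(A)]`. -/
def HasConvexRange {Ω : Type*} {S : Set (Set Ω)} (P : Charge S) : Prop :=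
  ∀ A ∈ S, {x : ℝ | ∃ B ∈ S, B ⊆ A ∧ P.toFun B = x} = Set.Icc 0 (P.toFun A)

/-- The loose anticore of a set function `v`. -/
def LooseAnticore {Ω : Type*} {S : Set (Set Ω)} (v : Set Ω → ℝ) : Set (Charge S) :=
  {μ | ∀ A ∈ S, μ.toFun A ≤ v A}

/-- The anticore of a set function `v`. -/
def Anticore {Ω : Type*} {S : Set (Set Ω)} (v : Set Ω → ℝ) : Set (Charge S) :=
  {μ | μ ∈ LooseAnticore v ∧ μ.toFun Set.univ = v Set.univ}

/-- The loose core of a set function `v`. -/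
def LooseCore {Ω : Type*} {S : Set (Set Ω)} (v : Set Ω → ℝ) : Set (Charge S) :=
  {μ | ∀ A ∈ S, v A ≤ μ.toFun A}

/-- The core of a set function `v`. -/
def Core {Ω : Type*} {S : Set (Set Ω)} (v : Set Ω → ℝ) : Set (Charge S) :=
  {μ | μ ∈ LooseCore v ∧ μ.toFun Set.univ = v Set.univ}

/-- The recursive family of set functions `(h_t)` built from the VaR capacity
`h_0(A) = 1` iff `P(A) > 1 − γ`. -/
noncomputable def hseq {Ω : Type*} {S : Set (Set Ω)} (P : Charge S) (γ : ℝ) :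
    ℕ → Set Ω → ℝ
  | 0 => fun A => if 1 - γ < P.toFun A then 1 else 0
  | t + 1 => fun A =>
      min (sSup {x : ℝ | ∃ B ∈ S,
        x = sInf {y : ℝ | ∃ C ∈ S, C ⊆ Aᶜ ∧
          y = hseq P γ t (A ∪ B) + hseq P γ t (A ∪ C) - hseq P γ t (B ∪ C)}}) 1

namespace Charge

variable {Ω : Type*} {S : Set (Set Ω)} {P : Charge S}

theorem toFun_empty (hS : MeasureTheory.IsSetAlgebra S) (P : Charge S) : P.toFun ∅ = 0 := by
  have h := P.additive ∅ ∅ hS.empty_mem hS.empty_mem disjoint_bot_left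
  rw [Set.union_empty] at h
  linarith

theorem toFun_compl (hS : MeasureTheory.IsSetAlgebra S) (hP : IsProbCharge P) {A : Set Ω}
    (hA : A ∈ S) : P.toFun Aᶜ = 1 - P.toFun A := by
  have h := P.additive A Aᶜ hA (hS.compl_mem hA) disjoint_compl_right
  rw [Set.union_compl_self, hP.1] at h
  linarith

theorem toFun_mono (hS : MeasureTheory.IsSetAlgebra S) (hP : IsProbCharge P) {A B : Set Ω}
    (hA : A ∈ S) (hB : B ∈ S) (hAB : A ⊆ B) : P.toFun A ≤ P.toFun B := by
  have h := P.additive A (B \ A) hA (hS.sdiff_mem hB hA) Set.disjoint_sdiff_right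
  rw [Set.union_sdiff_cancel hAB] at h
  linarith [hP.2 (B \ A)]

theorem toFun_union_le (hS : MeasureTheory.IsSetAlgebra S) (hP : IsProbCharge P) {A B : Set Ω}
    (hA : A ∈ S) (hB : B ∈ S) : P.toFun (A ∪ B) ≤ P.toFun A + P.toFun B := by
  have h := P.additive A (B \ A) hA (hS.sdiff_mem hB hA) Set.disjoint_sdiff_right
  rw [Set.union_sdiff_self] at h
  linarith [toFun_mono hS hP (hS.sdiff_mem hB hA) hB Set.sdiff_subset]

end Charge

section ThresholdStep

variable {Ω : Type*} {S : Set (Set Ω)} {P : Charge S}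

/-- Above half the threshold, some `B` keeps the inner expression at least one. -/
theorem exists_forall_one_le_of_half_lt (hS : MeasureTheory.IsSetAlgebra S)
    (hP : IsProbCharge P) (hPcr : HasConvexRange P) {c : ℝ} (hc : c ≤ 1 / 2) {h : Set Ω → ℝ}
    (hh : ∀ A ∈ S, h A = if c < P.toFun A then 1 else 0) {A : Set Ω} (hA : A ∈ S)
    (hcA : c / 2 < P.toFun A) :
    ∃ B ∈ S, ∀ C ∈ S, C ⊆ Aᶜ → 1 ≤ h (A ∪ B) + h (A ∪ C) - h (B ∪ C) := by
  obtain ⟨B, hB, hBA, hAB⟩ : ∃ B ∈ S, P.toFun B ≤ P.toFun A ∧ c < P.toFun (A ∪ B) := by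
    rcases lt_or_ge c (P.toFun A) with hlt | hle
    · exact ⟨A, hA, le_rfl, by rwa [Set.union_self]⟩
    · have hmem : P.toFun A ∈ Set.Icc 0 (P.toFun Aᶜ) :=
        ⟨hP.2 A, by rw [Charge.toFun_compl hS hP hA]; linarith⟩
      rw [← hPcr Aᶜ (hS.compl_mem hA)] at hmem
      obtain ⟨B, hB, hBA, hBeq⟩ := hmem
      refine ⟨B, hB, hBeq.le, ?_⟩
      rw [P.additive A B hA hB (Set.subset_compl_iff_disjoint_left.1 hBA)]
      linarith
  refine ⟨B, hB, fun C hC hCA => ?_⟩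
  have hAC := P.additive A C hA hC (Set.subset_compl_iff_disjoint_left.1 hCA)
  have hBC := Charge.toFun_union_le hS hP hB hC
  rw [hh _ (hS.union_mem hA hB), hh _ (hS.union_mem hA hC), hh _ (hS.union_mem hB hC),
    if_pos hAB]
  split_ifs <;> linarith

/-- Up to half the threshold, every `B` admits a `C` making the inner expression nonpositive. -/
theorem exists_le_zero_of_le_half (hS : MeasureTheory.IsSetAlgebra S)
    (hP : IsProbCharge P) (hPcr : HasConvexRange P) {c : ℝ} (hc₀ : 0 ≤ c) (hc : c ≤ 1 / 2)
    {h : Set Ω → ℝ} (hh : ∀ A ∈ S, h A = if c < P.toFun A then 1 else 0) {A B : Set Ω}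
    (hA : A ∈ S) (hB : B ∈ S) (hcA : P.toFun A ≤ c / 2) :
    ∃ C ∈ S, C ⊆ Aᶜ ∧ h (A ∪ B) + h (A ∪ C) - h (B ∪ C) ≤ 0 := by
  have hAB := hS.union_mem hA hB
  rcases le_or_gt (P.toFun (A ∪ B)) c with hle | hlt
  · refine ⟨∅, hS.empty_mem, Set.empty_subset _, ?_⟩
    rw [Set.union_empty, Set.union_empty, hh _ hAB, hh A hA, hh B hB, if_neg hle.not_gt,
      if_neg (by linarith)]
    split_ifs <;> norm_num
  · have hmem : min (c - P.toFun A) (P.toFun (A ∪ B)ᶜ) ∈ Set.Icc 0 (P.toFun (A ∪ B)ᶜ) :=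
      ⟨le_min (by linarith) (hP.2 _), min_le_right _ _⟩
    rw [← hPcr _ (hS.compl_mem hAB)] at hmem
    obtain ⟨C, hC, hCAB, hCeq⟩ := hmem
    have hCA : C ⊆ Aᶜ := hCAB.trans (Set.compl_subset_compl.2 Set.subset_union_left)
    have hCB : C ⊆ Bᶜ := hCAB.trans (Set.compl_subset_compl.2 Set.subset_union_right)
    have hAC := P.additive A C hA hC (Set.subset_compl_iff_disjoint_left.1 hCA)
    have hBC := P.additive B C hB hC (Set.subset_compl_iff_disjoint_left.1 hCB)
    have hsub := Charge.toFun_union_le hS hP hA hB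
    have hcompl := Charge.toFun_compl hS hP hAB
    refine ⟨C, hC, hCA, ?_⟩
    have hAC_le : P.toFun (A ∪ C) ≤ c := by
      linarith [min_le_left (c - P.toFun A) (P.toFun (A ∪ B)ᶜ)]
    have hBC_gt : c < P.toFun (B ∪ C) := by
      rcases min_choice (c - P.toFun A) (P.toFun (A ∪ B)ᶜ) with hmin | hmin <;>
        rw [hmin] at hCeq <;> linarith
    rw [hh _ hAB, hh _ (hS.union_mem hA hC), hh _ (hS.union_mem hB hC), if_pos hlt,
      if_neg hAC_le.not_gt, if_pos hBC_gt]
    norm_num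

/-- One step of the recursion turns the indicator of `{c < P}` into that of `{c / 2 < P}`. -/
theorem min_sSup_sInf_eq_ite (hS : MeasureTheory.IsSetAlgebra S)
    (hP : IsProbCharge P) (hPcr : HasConvexRange P) {c : ℝ} (hc₀ : 0 ≤ c) (hc : c ≤ 1 / 2)
    {h : Set Ω → ℝ} (hh : ∀ A ∈ S, h A = if c < P.toFun A then 1 else 0) {A : Set Ω}
    (hA : A ∈ S) :
    min (sSup {x : ℝ | ∃ B ∈ S, x = sInf {y : ℝ | ∃ C ∈ S, C ⊆ Aᶜ ∧
      y = h (A ∪ B) + h (A ∪ C) - h (B ∪ C)}}) 1 = if c / 2 < P.toFun A then 1 else 0 := by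
  have h_bounds : ∀ D ∈ S, 0 ≤ h D ∧ h D ≤ 1 := fun D hD => by
    rw [hh D hD]; split_ifs <;> norm_num
  have h_inf_le : ∀ B ∈ S, ∀ C ∈ S, C ⊆ Aᶜ → sInf {y : ℝ | ∃ C ∈ S, C ⊆ Aᶜ ∧
      y = h (A ∪ B) + h (A ∪ C) - h (B ∪ C)} ≤ h (A ∪ B) + h (A ∪ C) - h (B ∪ C) := by
    intro B hB C hC hCA
    refine csInf_le ⟨-1, ?_⟩ ⟨C, hC, hCA, rfl⟩
    rintro y ⟨D, hD, -, rfl⟩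
    linarith [(h_bounds _ (hS.union_mem hA hB)).1, (h_bounds _ (hS.union_mem hA hD)).1,
      (h_bounds _ (hS.union_mem hB hD)).2]
  have h_le_sup : ∀ B ∈ S, ∀ a : ℝ,
      (∀ C ∈ S, C ⊆ Aᶜ → a ≤ h (A ∪ B) + h (A ∪ C) - h (B ∪ C)) →
      a ≤ sSup {x : ℝ | ∃ B ∈ S, x = sInf {y : ℝ | ∃ C ∈ S, C ⊆ Aᶜ ∧
        y = h (A ∪ B) + h (A ∪ C) - h (B ∪ C)}} := by
    intro B hB a ha
    refine le_csSup_of_le ⟨2, ?_⟩ ⟨B, hB, rfl⟩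
      (le_csInf ⟨_, ∅, hS.empty_mem, Set.empty_subset _, rfl⟩ ?_)
    · rintro x ⟨D, hD, rfl⟩
      refine (h_inf_le D hD ∅ hS.empty_mem (Set.empty_subset _)).trans ?_
      linarith [(h_bounds _ (hS.union_mem hA hD)).2,
        (h_bounds _ (hS.union_mem hA hS.empty_mem)).2,
        (h_bounds _ (hS.union_mem hD hS.empty_mem)).1]
    · rintro y ⟨C, hC, hCA, rfl⟩
      exact ha C hC hCA
  split_ifs with hcA
  · obtain ⟨B, hB, hBC⟩ := exists_forall_one_le_of_half_lt hS hP hPcr hc hh hA hcA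
    exact min_eq_right (h_le_sup B hB 1 hBC)
  · rw [not_lt] at hcA
    have h_sup : sSup {x : ℝ | ∃ B ∈ S, x = sInf {y : ℝ | ∃ C ∈ S, C ⊆ Aᶜ ∧
        y = h (A ∪ B) + h (A ∪ C) - h (B ∪ C)}} = 0 := by
      refine le_antisymm (csSup_le ⟨_, ∅, hS.empty_mem, rfl⟩ ?_) (h_le_sup ∅ hS.empty_mem 0 ?_)
      · rintro x ⟨B, hB, rfl⟩
        obtain ⟨C, hC, hCA, hle⟩ := exists_le_zero_of_le_half hS hP hPcr hc₀ hc hh hA hB hcA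
        exact (h_inf_le B hB C hC hCA).trans hle
      · intro C hC _
        have hAC := hS.union_mem hA hC
        have h_mono := Charge.toFun_mono hS hP hC hAC Set.subset_union_right
        rw [Set.union_empty, Set.empty_union, hh A hA, hh _ hAC, hh C hC]
        split_ifs <;> linarith
    rw [h_sup]
    norm_num

end ThresholdStep

theorem hseq_eq_ite {Ω : Type*} {S : Set (Set Ω)} (hS : MeasureTheory.IsSetAlgebra S)
    {P : Charge S} (hP : IsProbCharge P) (hPcr : HasConvexRange P)
    {γ : ℝ} (hγ : γ ∈ Set.Ioo (1 / 2 : ℝ) 1) (t : ℕ) :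
    ∀ A ∈ S, hseq P γ t A = if (2 : ℝ) ^ (-(t : ℤ)) * (1 - γ) < P.toFun A then 1 else 0 := by
  obtain ⟨hγ₁, hγ₂⟩ := hγ
  induction t with
  | zero => intro A _; simp [hseq]
  | succ t ih =>
    intro A hA
    have h_pow : (2 : ℝ) ^ (-(t : ℤ)) ≤ 1 := zpow_le_one_of_nonpos₀ one_le_two (by simp)
    have h_pos : (0 : ℝ) < 2 ^ (-(t : ℤ)) := by positivity
    have h_half : (2 : ℝ) ^ (-((t + 1 : ℕ) : ℤ)) * (1 - γ) = 2 ^ (-(t : ℤ)) * (1 - γ) / 2 := by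
      rw [Nat.cast_succ, neg_add, zpow_add₀ two_ne_zero, zpow_neg_one]
      ring
    rw [h_half]
    exact min_sSup_sInf_eq_ite hS hP hPcr (mul_nonneg h_pos.le (by linarith))
      (by nlinarith) ih hA

/-- For a convex-ranged probability charge `P` on an algebra `S` and
`γ ∈ (1/2, 1)`, the recursively defined set functions `h_t` satisfy: (i) monotonicity in
`P`-probability; (ii) `h_t(∅) = 0`; (iii) `h_t(A) = 1` if `P(A) > 2^{−t}·(1 − γ)` and
`h_t(A) = 0` otherwise. -/
theorem stmt16 {Ω : Type*} (S : Set (Set Ω)) (hS : MeasureTheory.IsSetAlgebra S)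
    (P : Charge S) (hP : IsProbCharge P) (hPcr : HasConvexRange P)
    (γ : ℝ) (hγ : γ ∈ Set.Ioo (1 / 2 : ℝ) 1) :
    ∀ t : ℕ,
      (∀ A ∈ S, ∀ A' ∈ S, P.toFun A ≤ P.toFun A' →
        hseq (S := S) P γ t A ≤ hseq (S := S) P γ t A') ∧
      hseq (S := S) P γ t ∅ = 0 ∧
      (∀ A ∈ S, hseq (S := S) P γ t A =
        if (2 : ℝ) ^ (-(t : ℤ)) * (1 - γ) < P.toFun A then 1 else 0) := by
  intro t
  have h_eq := hseq_eq_ite hS hP hPcr hγ t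
  refine ⟨fun A hA A' hA' hle => ?_, ?_, h_eq⟩
  · rw [h_eq A hA, h_eq A' hA']
    split_ifs <;> linarith
  · have h_pos : (0 : ℝ) ≤ 2 ^ (-(t : ℤ)) * (1 - γ) :=
      mul_nonneg (by positivity) (by linarith [hγ.2])
    rw [h_eq ∅ hS.empty_mem, Charge.toFun_empty hS, if_neg h_pos.not_gt]
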